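/- Let d ≥ 2, 0 < s < 2, μ > 0. Then as h ↓ 0, the sum of absolute values of negative eigenvalues tr[-h²Δ - |x|^{-s} + μ]₋ is O(h^{-d}) if s < 2d/(d+2), is O(h^{-d}|log h|) if s = 2d/(d+2), and is O(h^{-2s/(2-s)}) if s > 2d/(d+2). -/

import Mathlib

open MeasureTheory

/-- The sum of absolute values of negative eigenvalues `tr[-h²Δ + V]₋`, realized
variationally as the supremum over finite orthonormal families of smooth compactly
supported functions of the sum of the negative parts of the energies. -/
noncomputable def negTrace (d : ℕ) (h : ℝ) (V : EuclideanSpace ℝ (Fin d) → ℝ) : ℝ :=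
  sSup { T : ℝ | ∃ (n : ℕ) (ψ : Fin n → EuclideanSpace ℝ (Fin d) → ℝ),
    (∀ i, ContDiff ℝ (⊤ : ℕ∞) (ψ i)) ∧ (∀ i, HasCompactSupport (ψ i)) ∧
    (∀ i j, (∫ x, ψ i x * ψ j x) = if i = j then 1 else 0) ∧
    T = ∑ i, max 0 (-(h ^ 2 * (∫ x, ‖fderiv ℝ (ψ i) x‖ ^ 2)
          + ∫ x, V x * (ψ i x) ^ 2)) }

/-- Cauchy–Schwarz for lower Lebesgue integrals. -/
theorem lintegral_mul_sq_le {α : Type*} [MeasurableSpace α] (ν : Measure α)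
    {f g : α → ENNReal} (hf : AEMeasurable f ν) (hg : AEMeasurable g ν) :
    (∫⁻ a, f a * g a ∂ν) ^ 2 ≤ (∫⁻ a, f a ^ 2 ∂ν) * ∫⁻ a, g a ^ 2 ∂ν := by
  have h := ENNReal.lintegral_mul_le_Lp_mul_Lq ν Real.HolderConjugate.two_two hf hg
  simp only [Pi.mul_apply, ENNReal.rpow_two] at h
  calc (∫⁻ a, f a * g a ∂ν) ^ 2 ≤ ((∫⁻ a, f a ^ 2 ∂ν) ^ (1 / 2 : ℝ) *
        (∫⁻ a, g a ^ 2 ∂ν) ^ (1 / 2 : ℝ)) ^ 2 := by gcongr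
    _ = _ := by
      rw [mul_pow, ← ENNReal.rpow_natCast, ← ENNReal.rpow_natCast, ← ENNReal.rpow_mul,
        ← ENNReal.rpow_mul]
      norm_num

/-- Bessel's inequality for the indicator function of a set, for an orthogonal family of functions
with common squared norm `κ`. -/
theorem sum_setIntegral_sq_le {E : Type*} [TopologicalSpace E] [T2Space E] [MeasurableSpace E]
    [OpensMeasurableSpace E] (ν : Measure E) [IsFiniteMeasureOnCompacts ν] {n : ℕ}
    {u : Fin n → E → ℝ} (hc : ∀ i, Continuous (u i)) (hs : ∀ i, HasCompactSupport (u i))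
    {κ : ℝ} (hκ : 0 < κ) (ho : ∀ i j, ∫ x, u i x * u j x ∂ν = if i = j then κ else 0)
    {B : Set E} (hB : ν B ≠ ⊤) :
    ∑ i, (∫ x in B, u i x ∂ν) ^ 2 ≤ κ * ν.real B := by
  set c : Fin n → ℝ := fun i => ∫ x in B, u i x ∂ν with hcdef
  set g : E → ℝ := fun x => ∑ i, c i * u i x with hg
  have hi : ∀ i, Integrable (u i) ν := fun i => (hc i).integrable_of_hasCompactSupport (hs i)
  have hij : ∀ i j, Integrable (fun x => u i x * u j x) ν := fun i j =>
    ((hc i).mul (hc j)).integrable_of_hasCompactSupport (hs i).mul_right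
  have hgB : ∫ x in B, g x ∂ν = ∑ i, c i ^ 2 := by
    rw [hg, integral_finsetSum]
    · simp [integral_const_mul, hcdef, sq]
    · exact fun i _ => ((hi i).const_mul _).integrableOn
  have hg2 : (fun x => g x ^ 2) = fun x => ∑ i, ∑ j, (c i * c j) * (u i x * u j x) := by
    funext x
    rw [hg, sq, Finset.sum_mul_sum]
    exact Finset.sum_congr rfl fun i _ => Finset.sum_congr rfl fun j _ => by ring
  have hg2i : Integrable (fun x => g x ^ 2) ν := by
    rw [hg2]
    exact integrable_finsetSum _ fun i _ => integrable_finsetSum _ fun j _ =>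
      (hij i j).const_mul _
  have hgi : Integrable g ν := integrable_finsetSum _ fun i _ => (hi i).const_mul _
  have hgT : ∫ x, g x ^ 2 ∂ν = κ * ∑ i, c i ^ 2 := by
    rw [hg2, integral_finsetSum _ fun i _ => integrable_finsetSum _ fun j _ =>
      (hij i j).const_mul _, Finset.mul_sum]
    refine Finset.sum_congr rfl fun i _ => ?_
    rw [integral_finsetSum _ fun j _ => (hij i j).const_mul _]
    simp only [integral_const_mul, ho]
    simp
    ring
  have hle : ∫ x in B, g x ^ 2 ∂ν ≤ ∫ x, g x ^ 2 ∂ν :=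
    setIntegral_le_integral hg2i (Filter.Eventually.of_forall fun x => sq_nonneg _)
  have hexp : ∫ x in B, (κ - g x) ^ 2 ∂ν
      = κ ^ 2 * ν.real B - 2 * κ * (∑ i, c i ^ 2) + ∫ x in B, g x ^ 2 ∂ν := by
    have h1 : Integrable (fun _ : E => κ ^ 2) (ν.restrict B) := integrableOn_const hB
    have h2 : Integrable (fun x : E => 2 * κ * g x) (ν.restrict B) :=
      (hgi.const_mul _).integrableOn
    have h12 : Integrable (fun x : E => κ ^ 2 - 2 * κ * g x) (ν.restrict B) := h1.sub h2
    calc ∫ x in B, (κ - g x) ^ 2 ∂ν = ∫ x in B, (κ ^ 2 - 2 * κ * g x + g x ^ 2) ∂ν := by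
          congr 1; funext x; ring
      _ = _ := by
        rw [integral_add h12 hg2i.integrableOn, integral_sub h1 h2, integral_const_mul,
          hgB, setIntegral_const, smul_eq_mul, mul_comm (ν.real B)]
  have hnn : 0 ≤ ∫ x in B, (κ - g x) ^ 2 ∂ν := integral_nonneg fun x => sq_nonneg _
  rw [hexp] at hnn
  have : κ * ∑ i, c i ^ 2 ≤ κ * (κ * ν.real B) := by nlinarith
  exact le_of_mul_le_mul_left this hκ

/-- Lower Lebesgue integrals under an antilipschitz change of variables. -/
theorem lintegral_comp_le_of_antilipschitz {E : Type*} [NormedAddCommGroup E]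
    [InnerProductSpace ℝ E] [FiniteDimensional ℝ E] [MeasurableSpace E] [BorelSpace E]
    {K : NNReal} {Φ : E → E} (hΦ : AntilipschitzWith K Φ) (hm : Measurable Φ)
    {f : E → ENNReal} (hf : Measurable f) :
    ∫⁻ x, f (Φ x) ≤ (K : ENNReal) ^ Module.finrank ℝ E * ∫⁻ x, f x := by
  have hvol : ∀ s : Set E, volume (Φ ⁻¹' s) ≤ (K : ENNReal) ^ Module.finrank ℝ E * volume s := by
    intro s
    have h0 := hΦ.hausdorffMeasure_preimage_le (d := Module.finrank ℝ E) (by positivity) s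
    rw [(Measure.isAddLeftInvariant_eq_smul (volume : Measure E)
      (Measure.hausdorffMeasure (Module.finrank ℝ E : ℝ)))]
    simp only [Measure.smul_apply, ENNReal.smul_def, smul_eq_mul]
    rw [mul_left_comm]
    gcongr
    simpa using h0
  have hmap : Measure.map Φ volume ≤ (K : ENNReal) ^ Module.finrank ℝ E • (volume : Measure E) := by
    refine Measure.le_iff.2 fun s hs => ?_
    rw [Measure.map_apply hm hs]
    simpa using hvol s
  calc ∫⁻ x, f (Φ x) = ∫⁻ x, f x ∂(Measure.map Φ volume) := (lintegral_map hf hm).symm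
    _ ≤ ∫⁻ x, f x ∂((K : ENNReal) ^ Module.finrank ℝ E • (volume : Measure E)) :=
      lintegral_mono' hmap le_rfl
    _ = _ := by simp

theorem lintegral_Ioo_rpow {r : ℝ} (hr : -1 < r) :
    ∫⁻ t in Set.Ioo (0 : ℝ) 1, ENNReal.ofReal (t ^ r) = ENNReal.ofReal (1 / (r + 1)) := by
  have hi : IntegrableOn (fun t : ℝ => t ^ r) (Set.Ioo 0 1) :=
    (intervalIntegral.integrableOn_Ioo_rpow_iff zero_lt_one).2 hr
  rw [← ofReal_integral_eq_lintegral_ofReal hi]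
  · congr 1
    rw [← integral_Ioc_eq_integral_Ioo, ← intervalIntegral.integral_of_le zero_le_one,
      integral_rpow (Or.inl hr)]
    simp [Real.zero_rpow (show r + 1 ≠ 0 by linarith)]
  · exact (ae_restrict_iff' measurableSet_Ioo).2
      (Filter.Eventually.of_forall fun t ht => Real.rpow_nonneg ht.1.le _)

/-- A weighted form of the mean value inequality along a segment. -/
theorem enorm_sub_sq_le_weighted {E : Type*} [NormedAddCommGroup E] [NormedSpace ℝ E]
    {u : E → ℝ} (hu : ContDiff ℝ 1 u) {a : ℝ} (ha1 : a < 1) (x w : E) :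
    ‖u x - u (x + w)‖ₑ ^ 2 ≤ ENNReal.ofReal (1 / (1 - a)) * (‖w‖ₑ ^ 2 *
      ∫⁻ t in Set.Ioo (0 : ℝ) 1, ENNReal.ofReal (t ^ a) * ‖fderiv ℝ u (x + t • w)‖ₑ ^ 2) := by
  have hd : ∀ t : ℝ, HasDerivAt (fun t : ℝ => u (x + t • w)) (fderiv ℝ u (x + t • w) w) t := by
    intro t
    have h1 : HasDerivAt (fun t : ℝ => x + t • w) w t := by
      simpa using ((hasDerivAt_id t).smul_const w).const_add x
    exact (hu.differentiable one_ne_zero _).hasFDerivAt.comp_hasDerivAt t h1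
  have hcf : Continuous fun t : ℝ => fderiv ℝ u (x + t • w) :=
    (hu.continuous_fderiv one_ne_zero).comp (by fun_prop)
  have hftc : ∫ t in (0 : ℝ)..1, fderiv ℝ u (x + t • w) w = u (x + w) - u x := by
    rw [intervalIntegral.integral_eq_sub_of_hasDerivAt (fun t _ => hd t)
      ((hcf.clm_apply continuous_const).intervalIntegrable _ _)]
    simp
  have h1 : ‖u x - u (x + w)‖ₑ ≤ ∫⁻ t in Set.Ioo (0 : ℝ) 1,
      ENNReal.ofReal (t ^ (-a / 2)) * (ENNReal.ofReal (t ^ (a / 2)) *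
        (‖fderiv ℝ u (x + t • w)‖ₑ * ‖w‖ₑ)) := by
    rw [← enorm_neg, neg_sub, ← hftc, intervalIntegral.integral_of_le zero_le_one,
      integral_Ioc_eq_integral_Ioo]
    refine (enorm_integral_le_lintegral_enorm _).trans
      (setLIntegral_mono' measurableSet_Ioo fun t ht => ?_)
    rw [← mul_assoc, ← ENNReal.ofReal_mul (Real.rpow_nonneg ht.1.le _), ← Real.rpow_add ht.1]
    simpa [show -a / 2 + a / 2 = 0 by ring] using ContinuousLinearMap.le_opENorm _ _
  have h2 := lintegral_mul_sq_le (volume.restrict (Set.Ioo (0 : ℝ) 1))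
    (f := fun t => ENNReal.ofReal (t ^ (-a / 2)))
    (g := fun t => ENNReal.ofReal (t ^ (a / 2)) * (‖fderiv ℝ u (x + t • w)‖ₑ * ‖w‖ₑ))
    (by fun_prop) ((by fun_prop : Measurable fun t : ℝ => ENNReal.ofReal (t ^ (a / 2))).mul
      ((hcf.enorm.measurable).mul_const _)).aemeasurable
  have hsq : ∀ t ∈ Set.Ioo (0 : ℝ) 1, ∀ b : ℝ,
      ENNReal.ofReal (t ^ (b / 2)) ^ 2 = ENNReal.ofReal (t ^ b) := by
    intro t ht b
    rw [← ENNReal.ofReal_pow (Real.rpow_nonneg ht.1.le _), ← Real.rpow_natCast,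
      ← Real.rpow_mul ht.1.le]
    congr 2; push_cast; ring
  refine (pow_le_pow_left' h1 2).trans (h2.trans (le_of_eq ?_))
  congr 1
  · rw [setLIntegral_congr_fun measurableSet_Ioo (fun t ht => hsq t ht (-a)),
      lintegral_Ioo_rpow (by linarith)]
    congr 2; ring
  · rw [← lintegral_const_mul' _ _ (by finiteness)]
    refine setLIntegral_congr_fun measurableSet_Ioo fun t ht => ?_
    simp only [mul_pow]
    rw [hsq t ht a]; ring

theorem continuous_fderiv_segment {E : Type*} [NormedAddCommGroup E] [NormedSpace ℝ E]
    {u : E → ℝ} (hu : ContDiff ℝ 1 u) {ℓ : E → ℝ} (hℓ : Continuous ℓ) :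
    Continuous fun q : E × (E × ℝ) => fderiv ℝ u (q.1 + q.2.2 • ℓ q.1 • q.2.1) :=
  (hu.continuous_fderiv one_ne_zero).comp (by fun_prop)

section Averages

open Metric Module

variable {E : Type*} [NormedAddCommGroup E] [InnerProductSpace ℝ E] [FiniteDimensional ℝ E]
  [MeasurableSpace E] [BorelSpace E]

/-- The mean value of `u` over the ball of radius `r` centred at `x`. -/
noncomputable def ballMean (u : E → ℝ) (r : ℝ) (x : E) : ℝ :=
  (volume.real (ball (0 : E) 1))⁻¹ * ∫ z in ball (0 : E) 1, u (x + r • z)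

/-- The weighted average of `‖∇u‖²` over the segments that join `x` to the points of the ball of
radius `r` centred at `x`. -/
noncomputable def segmentEnergy (a : ℝ) (u : E → ℝ) (r : ℝ) (x : E) : ENNReal :=
  ∫⁻ p in ball (0 : E) 1 ×ˢ Set.Ioo (0 : ℝ) 1,
    ENNReal.ofReal (p.2 ^ a) * ‖fderiv ℝ u (x + p.2 • r • p.1)‖ₑ ^ 2

theorem measurable_segmentEnergy {u : E → ℝ} (hu : ContDiff ℝ 1 u) (a : ℝ) {ℓ : E → ℝ}
    (hℓ : Continuous ℓ) : Measurable fun x => segmentEnergy a u (ℓ x) x := by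
  unfold segmentEnergy
  refine Measurable.lintegral_prod_right' (f := fun q : E × (E × ℝ) =>
    ENNReal.ofReal (q.2.2 ^ a) * ‖fderiv ℝ u (q.1 + q.2.2 • ℓ q.1 • q.2.1)‖ₑ ^ 2) ?_
  exact (by fun_prop : Measurable fun q : E × (E × ℝ) => ENNReal.ofReal (q.2.2 ^ a)).mul
    ((continuous_fderiv_segment hu hℓ).enorm.measurable.pow_const 2)

theorem enorm_sq_le_ballMean_add_segmentEnergy {u : E → ℝ} (hu : ContDiff ℝ 1 u) {a : ℝ}
    (ha1 : a < 1) (r : ℝ) (x : E) :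
    ‖u x‖ₑ ^ 2 ≤ 2 * ‖ballMean u r x‖ₑ ^ 2 +
      2 * ((volume (ball (0 : E) 1))⁻¹ * (ENNReal.ofReal (1 / (1 - a)) *
        (ENNReal.ofReal (r ^ 2) * segmentEnergy a u r x))) := by
  set B := ball (0 : E) 1 with hB
  have hb0 : volume B ≠ 0 := (measure_ball_pos volume _ one_pos).ne'
  have hbt : volume B ≠ ⊤ := measure_ball_lt_top.ne
  have hbr : volume.real B ≠ 0 := (ENNReal.toReal_pos hb0 hbt).ne'
  have hcont : Continuous fun z : E => u (x + r • z) := hu.continuous.comp (by fun_prop)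
  have hint : IntegrableOn (fun z : E => u (x + r • z)) B :=
    (hcont.continuousOn.integrableOn_compact (isCompact_closedBall (0 : E) 1)).mono_set
      ball_subset_closedBall
  have hsub : u x - ballMean u r x
      = (volume.real B)⁻¹ * ∫ z in B, (u x - u (x + r • z)) := by
    have hcu : Integrable (fun _ : E => u x) (volume.restrict B) := integrableOn_const hbt
    rw [integral_sub hcu hint, setIntegral_const, ballMean, mul_sub, smul_eq_mul,
      inv_mul_cancel_left₀ hbr]
  have h1 : ‖u x - ballMean u r x‖ₑ ≤
      (volume B)⁻¹ * ∫⁻ z in B, 1 * ‖u x - u (x + r • z)‖ₑ := by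
    rw [hsub, enorm_mul]
    simp only [one_mul]
    gcongr
    · rw [enorm_inv hbr, Real.enorm_of_nonneg measureReal_nonneg, measureReal_def,
        ENNReal.ofReal_toReal hbt]
    · exact enorm_integral_le_lintegral_enorm _
  have h2 := lintegral_mul_sq_le (volume.restrict B) (f := fun _ : E => 1)
    (g := fun z => ‖u x - u (x + r • z)‖ₑ) (by fun_prop)
    ((continuous_const.sub hcont).enorm.measurable.aemeasurable)
  have h3 : ∫⁻ z in B, ‖u x - u (x + r • z)‖ₑ ^ 2 ≤ ENNReal.ofReal (1 / (1 - a)) *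
      (ENNReal.ofReal (r ^ 2) * segmentEnergy a u r x) := by
    have hprod : segmentEnergy a u r x = ∫⁻ z in B, ∫⁻ t in Set.Ioo (0 : ℝ) 1,
        ENNReal.ofReal (t ^ a) * ‖fderiv ℝ u (x + t • r • z)‖ₑ ^ 2 := by
      rw [segmentEnergy, Measure.volume_eq_prod, ← Measure.prod_restrict, lintegral_prod]
      refine Measurable.aemeasurable ?_
      exact (by fun_prop : Measurable fun q : E × ℝ => ENNReal.ofReal (q.2 ^ a)).mul
        (Continuous.measurable (((hu.continuous_fderiv one_ne_zero).comp
          (by fun_prop : Continuous fun q : E × ℝ => x + q.2 • r • q.1)).enorm) |>.pow_const 2)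
    rw [hprod, ← lintegral_const_mul' _ _ (by finiteness), ← lintegral_const_mul' _ _ (by finiteness)]
    refine setLIntegral_mono' measurableSet_ball fun z hz => ?_
    refine (enorm_sub_sq_le_weighted hu ha1 x (r • z)).trans ?_
    gcongr
    rw [enorm_smul, mul_pow, ← Real.enorm_of_nonneg (sq_nonneg r), enorm_pow]
    refine mul_le_of_le_one_right' (pow_le_one' ?_ 2)
    rw [← ofReal_norm, ENNReal.ofReal_le_one]
    exact (mem_ball_zero_iff.1 hz).le
  have h4 : ‖u x - ballMean u r x‖ₑ ^ 2 ≤ (volume B)⁻¹ * (ENNReal.ofReal (1 / (1 - a)) *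
      (ENNReal.ofReal (r ^ 2) * segmentEnergy a u r x)) := by
    refine (pow_le_pow_left' h1 2).trans ?_
    rw [mul_pow]
    refine (mul_le_mul_right h2 _).trans ?_
    simp only [one_pow, lintegral_const, Measure.restrict_apply_univ, one_mul]
    rw [sq, mul_assoc, ← mul_assoc (volume B)⁻¹ (volume B), ENNReal.inv_mul_cancel hb0 hbt, one_mul]
    gcongr
  have h5 : ‖u x‖ₑ ≤ ‖ballMean u r x‖ₑ + ‖u x - ballMean u r x‖ₑ := by
    refine le_trans (le_of_eq ?_) (enorm_add_le _ _)
    congr 1; ring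
  calc ‖u x‖ₑ ^ 2 ≤ (‖ballMean u r x‖ₑ + ‖u x - ballMean u r x‖ₑ) ^ 2 := by gcongr
    _ ≤ 2 * ‖ballMean u r x‖ₑ ^ 2 + 2 * ‖u x - ballMean u r x‖ₑ ^ 2 := by
      have := ENNReal.rpow_add_le_mul_rpow_add_rpow ‖ballMean u r x‖ₑ ‖u x - ballMean u r x‖ₑ
        (p := 2) (by norm_num)
      norm_num [mul_add] at this
      simpa using this
    _ ≤ _ := by gcongr

theorem lintegral_segmentEnergy_le {u : E → ℝ} (hu : ContDiff ℝ 1 u) {a : ℝ} (ha : 0 ≤ a)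
    {ℓ : E → ℝ} (hℓ : LipschitzWith (1 / 2) ℓ) :
    ∫⁻ x, segmentEnergy a u (ℓ x) x ≤
      volume (ball (0 : E) 1) * (2 ^ finrank ℝ E * ∫⁻ x, ‖fderiv ℝ u x‖ₑ ^ 2) := by
  have hmeas : Measurable fun q : E × (E × ℝ) =>
      ENNReal.ofReal (q.2.2 ^ a) * ‖fderiv ℝ u (q.1 + q.2.2 • ℓ q.1 • q.2.1)‖ₑ ^ 2 :=
    (by fun_prop : Measurable fun q : E × (E × ℝ) => ENNReal.ofReal (q.2.2 ^ a)).mul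
      ((continuous_fderiv_segment hu hℓ.continuous).enorm.measurable.pow_const 2)
  unfold segmentEnergy
  rw [lintegral_lintegral_swap hmeas.aemeasurable]
  have hvol : volume (ball (0 : E) 1 ×ˢ Set.Ioo (0 : ℝ) 1) = volume (ball (0 : E) 1) := by
    rw [Measure.volume_eq_prod, Measure.prod_prod]; simp
  have hS : MeasurableSet (ball (0 : E) 1 ×ˢ Set.Ioo (0 : ℝ) 1) :=
    measurableSet_ball.prod measurableSet_Ioo
  calc _ ≤ ∫⁻ _ in ball (0 : E) 1 ×ˢ Set.Ioo (0 : ℝ) 1,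
        2 ^ finrank ℝ E * ∫⁻ x, ‖fderiv ℝ u x‖ₑ ^ 2 := by
        refine setLIntegral_mono' hS fun p hp => ?_
        obtain ⟨hz, ht⟩ := hp
        have hz' : ‖p.1‖ < 1 := mem_ball_zero_iff.1 hz
        have hanti : AntilipschitzWith 2 fun x : E => x + p.2 • ℓ x • p.1 := by
          refine AntilipschitzWith.of_le_mul_dist fun x y => ?_
          have h1 : ‖(p.2 * (ℓ x - ℓ y)) • p.1‖ ≤ 1 / 2 * ‖x - y‖ := by
            have h2 := hℓ.dist_le_mul x y
            rw [Real.dist_eq, dist_eq_norm] at h2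
            rw [norm_smul, norm_mul, Real.norm_of_nonneg ht.1.le, Real.norm_eq_abs]
            have h3 : p.2 * |ℓ x - ℓ y| ≤ |ℓ x - ℓ y| :=
              mul_le_of_le_one_left (abs_nonneg _) ht.2.le
            calc p.2 * |ℓ x - ℓ y| * ‖p.1‖ ≤ |ℓ x - ℓ y| * 1 := by
                  gcongr
              _ ≤ _ := by simpa using h2
          have h2 : x - y = (x + p.2 • ℓ x • p.1 - (y + p.2 • ℓ y • p.1))
              - (p.2 * (ℓ x - ℓ y)) • p.1 := by
            rw [mul_sub, sub_smul, mul_smul, mul_smul]; abel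
          have h3 := norm_sub_le (x + p.2 • ℓ x • p.1 - (y + p.2 • ℓ y • p.1))
            ((p.2 * (ℓ x - ℓ y)) • p.1)
          rw [← h2] at h3
          rw [dist_eq_norm, dist_eq_norm]
          push_cast
          linarith
        have hcΦ : Continuous fun x : E => x + p.2 • ℓ x • p.1 := by
          have := hℓ.continuous
          fun_prop
        have hle := lintegral_comp_le_of_antilipschitz hanti hcΦ.measurable
          (f := fun y => ‖fderiv ℝ u y‖ₑ ^ 2)
          ((hu.continuous_fderiv one_ne_zero).enorm.measurable.pow_const 2)
        refine le_trans (lintegral_mono fun x => ?_) (by simpa using hle)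
        refine mul_le_of_le_one_left' ?_
        rw [ENNReal.ofReal_le_one]
        exact Real.rpow_le_one ht.1.le ht.2.le ha
    _ = _ := by
      rw [lintegral_const, Measure.restrict_apply_univ, hvol, mul_comm]

theorem setLIntegral_norm_sub_rpow_le {s : ℝ} (hs : 0 ≤ s) (q : E) :
    ∫⁻ z in ball (0 : E) 1, ENNReal.ofReal (‖q - z‖ ^ (-s)) ≤
      volume (ball (0 : E) 1) + ∫⁻ z in ball (0 : E) 1, ENNReal.ofReal (‖z‖ ^ (-s)) := by
  set f : E → ENNReal := (ball (0 : E) 1).indicator fun z => ENNReal.ofReal (‖z‖ ^ (-s)) with hf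
  calc ∫⁻ z in ball (0 : E) 1, ENNReal.ofReal (‖q - z‖ ^ (-s))
      ≤ ∫⁻ z in ball (0 : E) 1, (1 + f (q - z)) := by
        refine lintegral_mono fun z => ?_
        by_cases hz : q - z ∈ ball (0 : E) 1
        · simp [hf, Set.indicator_of_mem hz]
        · refine le_add_right ?_
          rw [ENNReal.ofReal_le_one]
          exact Real.rpow_le_one_of_one_le_of_nonpos (by simpa using hz) (by linarith)
    _ = volume (ball (0 : E) 1) + ∫⁻ z in ball (0 : E) 1, f (q - z) := by
        rw [lintegral_add_left measurable_const]; simp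
    _ ≤ volume (ball (0 : E) 1) + ∫⁻ z, f (q - z) := by
        exact add_le_add_right (setLIntegral_le_lintegral _ _) _
    _ = _ := by
        rw [lintegral_sub_left_eq_self, hf, lintegral_indicator measurableSet_ball]

theorem lintegral_rpow_mul_segmentEnergy_le {u : E → ℝ} (hu : ContDiff ℝ 1 u) {s : ℝ}
    (hs0 : 0 < s) (hs2 : s < 2) {r : ℝ} (hr : 0 < r) :
    ∫⁻ x, ENNReal.ofReal (‖x‖ ^ (-s)) * segmentEnergy (s / 2) u r x ≤
      ENNReal.ofReal (r ^ (-s)) * (ENNReal.ofReal (1 / (1 - s / 2)) *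
        ((volume (ball (0 : E) 1) + ∫⁻ z in ball (0 : E) 1, ENNReal.ofReal (‖z‖ ^ (-s))) *
          ∫⁻ x, ‖fderiv ℝ u x‖ₑ ^ 2)) := by
  set M := volume (ball (0 : E) 1) + ∫⁻ z in ball (0 : E) 1, ENNReal.ofReal (‖z‖ ^ (-s)) with hM
  set S := ball (0 : E) 1 ×ˢ Set.Ioo (0 : ℝ) 1 with hS
  set G : E → ENNReal := fun x => ‖fderiv ℝ u x‖ₑ ^ 2 with hG
  have hGm : Measurable G := (hu.continuous_fderiv one_ne_zero).enorm.measurable.pow_const 2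
  have hinner : ∀ y : E, ∫⁻ p in S, ENNReal.ofReal (p.2 ^ (s / 2)) *
      ENNReal.ofReal (‖y - p.2 • r • p.1‖ ^ (-s)) ≤
      ENNReal.ofReal (r ^ (-s)) * (ENNReal.ofReal (1 / (1 - s / 2)) * M) := by
    intro y
    rw [hS, Measure.volume_eq_prod, ← Measure.prod_restrict, lintegral_prod_symm _ (by fun_prop)]
    calc _ ≤ ∫⁻ t in Set.Ioo (0 : ℝ) 1, ENNReal.ofReal (r ^ (-s)) *
          (ENNReal.ofReal (t ^ (-(s / 2))) * M) := by
          refine setLIntegral_mono' measurableSet_Ioo fun t ht => ?_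
          have htr : 0 < t * r := mul_pos ht.1 hr
          have hscale : ∀ z : E, ENNReal.ofReal (t ^ (s / 2)) *
              ENNReal.ofReal (‖y - t • r • z‖ ^ (-s)) =
              ENNReal.ofReal (r ^ (-s) * t ^ (-(s / 2))) *
                ENNReal.ofReal (‖(t * r)⁻¹ • y - z‖ ^ (-s)) := by
            intro z
            have h1 : y - t • r • z = (t * r) • ((t * r)⁻¹ • y - z) := by
              rw [smul_sub, smul_inv_smul₀ htr.ne', mul_smul]
            rw [h1, norm_smul, Real.norm_of_nonneg htr.le,
              Real.mul_rpow htr.le (norm_nonneg _), Real.mul_rpow ht.1.le hr.le,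
              ← ENNReal.ofReal_mul (Real.rpow_nonneg ht.1.le _),
              ← ENNReal.ofReal_mul (mul_nonneg (Real.rpow_nonneg hr.le _)
                (Real.rpow_nonneg ht.1.le _)),
              show -(s / 2) = s / 2 + -s by ring, Real.rpow_add ht.1]
            congr 1; ring
          simp only [hscale]
          rw [lintegral_const_mul' _ _ (by finiteness), ENNReal.ofReal_mul
            (Real.rpow_nonneg hr.le _), mul_assoc]
          gcongr
          exact setLIntegral_norm_sub_rpow_le hs0.le _
      _ = _ := by
          rw [lintegral_const_mul' _ _ (by finiteness), lintegral_mul_const _ (by fun_prop),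
            lintegral_Ioo_rpow (by linarith)]
          congr 4; ring
  calc ∫⁻ x, ENNReal.ofReal (‖x‖ ^ (-s)) * segmentEnergy (s / 2) u r x
      = ∫⁻ x, ∫⁻ p in S, ENNReal.ofReal (‖x‖ ^ (-s)) *
          (ENNReal.ofReal (p.2 ^ (s / 2)) * G (x + p.2 • r • p.1)) := by
        refine lintegral_congr fun x => ?_
        rw [segmentEnergy, lintegral_const_mul' _ _ (by finiteness)]
    _ = ∫⁻ p in S, ∫⁻ x, ENNReal.ofReal (‖x‖ ^ (-s)) *
          (ENNReal.ofReal (p.2 ^ (s / 2)) * G (x + p.2 • r • p.1)) :=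
        lintegral_lintegral_swap (by fun_prop)
    _ = ∫⁻ p in S, ∫⁻ y, G y * (ENNReal.ofReal (p.2 ^ (s / 2)) *
          ENNReal.ofReal (‖y - p.2 • r • p.1‖ ^ (-s))) := by
        refine lintegral_congr fun p => ?_
        rw [← lintegral_sub_right_eq_self _ (p.2 • r • p.1)]
        refine lintegral_congr fun y => ?_
        rw [sub_add_cancel]; ring
    _ = ∫⁻ y, ∫⁻ p in S, G y * (ENNReal.ofReal (p.2 ^ (s / 2)) *
          ENNReal.ofReal (‖y - p.2 • r • p.1‖ ^ (-s))) :=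
        lintegral_lintegral_swap (by fun_prop)
    _ ≤ ∫⁻ y, G y * (ENNReal.ofReal (r ^ (-s)) * (ENNReal.ofReal (1 / (1 - s / 2)) * M)) := by
        refine lintegral_mono fun y => ?_
        rw [lintegral_const_mul' _ _ (by simp [hG])]
        gcongr
        exact hinner y
    _ = _ := by
        rw [lintegral_mul_const _ hGm]; ring

end Averages

section TraceBound

open Metric Module

theorem abs_rpow_max_sub_rpow_max_le {p : ℝ} (hp0 : 0 ≤ p) (hp1 : p ≤ 1) {δ : ℝ} (hδ : 0 < δ)
    (a b : ℝ) : |max a δ ^ p - max b δ ^ p| ≤ δ ^ (p - 1) * |a - b| := by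
  have key : ∀ x y : ℝ, δ ≤ y → y ≤ x → x ^ p - y ^ p ≤ δ ^ (p - 1) * (x - y) := by
    intro x y hy hxy
    have hy0 : 0 < y := hδ.trans_le hy
    have hx0 : 0 < x := hy0.trans_le hxy
    have h1 : x ^ (p - 1) ≤ y ^ (p - 1) := Real.rpow_le_rpow_of_nonpos hy0 hxy (by linarith)
    have h2 : y ^ (p - 1) ≤ δ ^ (p - 1) := Real.rpow_le_rpow_of_nonpos hδ hy (by linarith)
    have h3 : x ^ p = x ^ (p - 1) * x := by
      rw [← Real.rpow_add_one hx0.ne', sub_add_cancel]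
    have h4 : y ^ p = y ^ (p - 1) * y := by
      rw [← Real.rpow_add_one hy0.ne', sub_add_cancel]
    rw [h3, h4]
    nlinarith
  have hmax : |max a δ - max b δ| ≤ |a - b| := abs_max_sub_max_le_abs a b δ
  have hδp : 0 ≤ δ ^ (p - 1) := Real.rpow_nonneg hδ.le _
  refine le_trans ?_ (mul_le_mul_of_nonneg_left hmax hδp)
  rcases le_total (max b δ) (max a δ) with h | h
  · rw [abs_of_nonneg (sub_nonneg.2 h), abs_of_nonneg]
    · exact key _ _ (le_max_right _ _) h
    · exact sub_nonneg.2 (Real.rpow_le_rpow (hδ.le.trans (le_max_right _ _)) h hp0)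
  · rw [abs_sub_comm, abs_sub_comm (max a δ), abs_of_nonneg (sub_nonneg.2 h), abs_of_nonneg]
    · exact key _ _ (le_max_right _ _) h
    · exact sub_nonneg.2 (Real.rpow_le_rpow (hδ.le.trans (le_max_right _ _)) h hp0)

/-- The averaging length at `x`, constant in the quantum region `‖x‖ ≤ δ` and of the order of the
local wavelength `h ‖x‖ ^ (s / 2)` in the classical region. -/
noncomputable def localLength {E : Type*} [NormedAddCommGroup E] (s ε h δ : ℝ) (x : E) : ℝ :=
  ε * (h * max ‖x‖ δ ^ (s / 2))

theorem localLength_pos {E : Type*} [NormedAddCommGroup E] {s ε h δ : ℝ} (hε : 0 < ε) (hh : 0 < h)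
    (hδ : 0 < δ) (x : E) : 0 < localLength s ε h δ x :=
  mul_pos hε (mul_pos hh (Real.rpow_pos_of_pos (lt_max_of_lt_right hδ) _))

theorem lipschitzWith_localLength {E : Type*} [NormedAddCommGroup E] {s ε h δ : ℝ} (hs0 : 0 ≤ s)
    (hs2 : s ≤ 2) (hε : 0 ≤ ε) (hε2 : ε ≤ 1 / 2) (hh : 0 ≤ h) (hδ : 0 < δ)
    (hscale : h * δ ^ (s / 2) = δ) :
    LipschitzWith (1 / 2) (localLength s ε h δ : E → ℝ) := by
  refine LipschitzWith.of_dist_le_mul fun x y => ?_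
  have h1 := abs_rpow_max_sub_rpow_max_le (p := s / 2) (by linarith) (by linarith) hδ ‖x‖ ‖y‖
  have h2 : h * δ ^ (s / 2 - 1) = 1 := by
    rw [Real.rpow_sub_one hδ.ne', ← mul_div_assoc, hscale, div_self hδ.ne']
  rw [Real.dist_eq, localLength, localLength, ← mul_sub, ← mul_sub, abs_mul, abs_mul,
    abs_of_nonneg hε, abs_of_nonneg hh, dist_eq_norm]
  calc ε * (h * |max ‖x‖ δ ^ (s / 2) - max ‖y‖ δ ^ (s / 2)|)
      ≤ ε * (h * (δ ^ (s / 2 - 1) * |‖x‖ - ‖y‖|)) := by gcongr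
    _ = ε * |‖x‖ - ‖y‖| := by rw [← mul_assoc h, h2, one_mul]
    _ ≤ 1 / 2 * ‖x - y‖ := by
      gcongr
      exact abs_norm_sub_norm_le x y
    _ = _ := by simp

variable {E : Type*} [NormedAddCommGroup E] [InnerProductSpace ℝ E] [FiniteDimensional ℝ E]
  [MeasurableSpace E] [BorelSpace E]

theorem setLIntegral_norm_rpow_ball_lt_top {s : ℝ} (hE : 1 ≤ finrank ℝ E) (hs : s < finrank ℝ E) :
    ∫⁻ z in ball (0 : E) 1, ENNReal.ofReal (‖z‖ ^ (-s)) < ⊤ := by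
  have hi : IntegrableOn (fun z : E => ‖z‖ ^ (-s)) (ball 0 1) := by
    refine integrableOn_ball_of_norm_le_rpow hE (C := 1) hs ?_
      (by fun_prop : Measurable fun z : E => ‖z‖ ^ (-s)).aestronglyMeasurable
    exact Filter.Eventually.of_forall fun z => by
      rw [one_mul, Real.norm_of_nonneg (Real.rpow_nonneg (norm_nonneg _) _)]
  exact hi.lintegral_lt_top

theorem rpow_mul_localLength_mul_segmentEnergy_le {s ε h δ : ℝ} (hδ : 0 < δ)
    (hscale : h * δ ^ (s / 2) = δ) (u : E → ℝ) (x : E) :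
    ENNReal.ofReal (‖x‖ ^ (-s)) * (ENNReal.ofReal (localLength s ε h δ x ^ 2) *
        segmentEnergy (s / 2) u (localLength s ε h δ x) x) ≤
      ENNReal.ofReal ((ε * δ) ^ 2) *
          (ENNReal.ofReal (‖x‖ ^ (-s)) * segmentEnergy (s / 2) u (ε * δ) x) +
        ENNReal.ofReal ((ε * h) ^ 2) *
          segmentEnergy (s / 2) u (localLength s ε h δ x) x := by
  rcases le_total ‖x‖ δ with hx | hx
  · have : localLength s ε h δ x = ε * δ := by rw [localLength, max_eq_right hx, hscale]
    rw [this, mul_left_comm]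
    exact le_self_add
  · refine le_add_left ?_
    rw [← mul_assoc, ← ENNReal.ofReal_mul (Real.rpow_nonneg (norm_nonneg _) _)]
    gcongr
    have hx0 : 0 < ‖x‖ := hδ.trans_le hx
    have h1 : (‖x‖ ^ (s / 2)) ^ 2 = ‖x‖ ^ s := by
      rw [← Real.rpow_natCast, ← Real.rpow_mul hx0.le]; congr 1; push_cast; ring
    have h2 : ‖x‖ ^ (-s) * ‖x‖ ^ s = 1 := by
      rw [← Real.rpow_add hx0, neg_add_cancel, Real.rpow_zero]
    rw [localLength, max_eq_left hx, mul_pow, mul_pow, h1]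
    refine le_of_eq ?_
    linear_combination (ε ^ 2 * h ^ 2) * h2

/-- On a set `A`, the potential energy in `‖x‖ ^ (-s)` is controlled by the potential energy of the
local mean values and the kinetic energy. -/
theorem exists_setLIntegral_rpow_mul_sq_le (s : ℝ) (hs0 : 0 < s) (hs2 : s < 2)
    (hE : 2 ≤ finrank ℝ E) :
    ∃ ε : ℝ, 0 < ε ∧ ε ≤ 1 / 2 ∧ ∀ h δ : ℝ, 0 < h → 0 < δ → h * δ ^ (s / 2) = δ →
      ∀ u : E → ℝ, ContDiff ℝ 1 u → ∀ A : Set E,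
        ∫⁻ x in A, ENNReal.ofReal (‖x‖ ^ (-s)) * ‖u x‖ₑ ^ 2 ≤
          (∫⁻ x in A, ENNReal.ofReal (‖x‖ ^ (-s)) *
            (2 * ‖ballMean u (localLength s ε h δ x) x‖ₑ ^ 2)) +
          ENNReal.ofReal (h ^ 2) * ∫⁻ x, ‖fderiv ℝ u x‖ₑ ^ 2 := by
  set b := volume (ball (0 : E) 1) with hb
  have hb0 : b ≠ 0 := (measure_ball_pos volume _ one_pos).ne'
  have hbt : b ≠ ⊤ := measure_ball_lt_top.ne
  set K := ENNReal.ofReal (1 / (1 - s / 2)) with hK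
  set M := b + ∫⁻ z in ball (0 : E) 1, ENNReal.ofReal (‖z‖ ^ (-s)) with hM
  have hE' : (2 : ℝ) ≤ finrank ℝ E := by exact_mod_cast hE
  have hMt : M ≠ ⊤ := ENNReal.add_ne_top.2
    ⟨hbt, (setLIntegral_norm_rpow_ball_lt_top (by lia) (by linarith)).ne⟩
  set Z := 2 * (b⁻¹ * (K * (K * M + b * 2 ^ finrank ℝ E))) with hZ
  have hZt : Z ≠ ⊤ := by
    have : b⁻¹ ≠ ⊤ := ENNReal.inv_ne_top.2 hb0
    finiteness
  obtain ⟨ε, hε0, hε2, hεZ⟩ : ∃ ε : ℝ, 0 < ε ∧ ε ≤ 1 / 2 ∧ ENNReal.ofReal (ε ^ (2 - s)) * Z ≤ 1 := by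
    have hZ1 : 0 < (Z.toReal + 1)⁻¹ := by positivity
    refine ⟨min (1 / 2) ((Z.toReal + 1)⁻¹ ^ (1 / (2 - s))),
      lt_min (by norm_num) (Real.rpow_pos_of_pos hZ1 _), min_le_left _ _, ?_⟩
    have h1 : min (1 / 2) ((Z.toReal + 1)⁻¹ ^ (1 / (2 - s))) ^ (2 - s) ≤ (Z.toReal + 1)⁻¹ := by
      calc _ ≤ ((Z.toReal + 1)⁻¹ ^ (1 / (2 - s))) ^ (2 - s) :=
            Real.rpow_le_rpow (le_min (by norm_num) (Real.rpow_nonneg hZ1.le _))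
              (min_le_right _ _) (by linarith)
        _ = _ := by
            rw [← Real.rpow_mul hZ1.le, one_div_mul_cancel (by linarith), Real.rpow_one]
    calc _ ≤ ENNReal.ofReal (Z.toReal + 1)⁻¹ * ENNReal.ofReal Z.toReal := by
          rw [ENNReal.ofReal_toReal hZt]; gcongr
      _ ≤ 1 := by
          rw [← ENNReal.ofReal_mul hZ1.le, ENNReal.ofReal_le_one, inv_mul_le_iff₀ (by positivity)]
          linarith
  refine ⟨ε, hε0, hε2, fun h δ hh hδ hscale u hu A => ?_⟩
  set D := ∫⁻ x, ‖fderiv ℝ u x‖ₑ ^ 2 with hD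
  set ℓ : E → ℝ := localLength s ε h δ with hℓ
  have hLip : LipschitzWith (1 / 2) ℓ :=
    lipschitzWith_localLength hs0.le hs2.le hε0.le hε2 hh.le hδ hscale
  have hmW : Measurable fun x : E => ENNReal.ofReal (‖x‖ ^ (-s)) := by fun_prop
  have hmV := measurable_segmentEnergy hu (s / 2) hLip.continuous
  have hεδ : 0 < ε * δ := mul_pos hε0 hδ
  have hrem : ∫⁻ x, ENNReal.ofReal (‖x‖ ^ (-s)) * (ENNReal.ofReal (ℓ x ^ 2) *
      segmentEnergy (s / 2) u (ℓ x) x) ≤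
      ENNReal.ofReal (h ^ 2) * (ENNReal.ofReal (ε ^ (2 - s)) *
        ((K * M + b * 2 ^ finrank ℝ E) * D)) := by
    refine (lintegral_mono fun x => rpow_mul_localLength_mul_segmentEnergy_le hδ
      hscale u x).trans ?_
    rw [lintegral_add_right _ (hmV.const_mul _), lintegral_const_mul' _ _ (by finiteness),
      lintegral_const_mul _ hmV]
    have h1 := lintegral_rpow_mul_segmentEnergy_le hu hs0 hs2 hεδ
    have h2 := lintegral_segmentEnergy_le hu (a := s / 2) (by linarith) hLip
    have h3 : ENNReal.ofReal ((ε * δ) ^ 2) * ENNReal.ofReal ((ε * δ) ^ (-s)) =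
        ENNReal.ofReal (h ^ 2) * ENNReal.ofReal (ε ^ (2 - s)) := by
      rw [← ENNReal.ofReal_mul (by positivity), ← ENNReal.ofReal_mul (by positivity)]
      congr 1
      have h4 : (δ ^ (s / 2)) ^ 2 = δ ^ s := by
        rw [← Real.rpow_natCast, ← Real.rpow_mul hδ.le]; congr 1; push_cast; ring
      have h5 : δ ^ s * δ ^ (-s) = 1 := by
        rw [← Real.rpow_add hδ, add_neg_cancel, Real.rpow_zero]
      have h6 : ε ^ (2 - s) = ε ^ 2 * ε ^ (-s) := by
        rw [sub_eq_add_neg, Real.rpow_add hε0, Real.rpow_two]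
      have h7 : δ ^ 2 = h ^ 2 * δ ^ s := by rw [← h4, ← mul_pow, hscale]
      rw [Real.mul_rpow hε0.le hδ.le, h6, mul_pow, h7]
      linear_combination (ε ^ 2 * h ^ 2 * ε ^ (-s)) * h5
    have h8 : ENNReal.ofReal ((ε * h) ^ 2) ≤
        ENNReal.ofReal (h ^ 2) * ENNReal.ofReal (ε ^ (2 - s)) := by
      rw [← ENNReal.ofReal_mul (by positivity), mul_pow, mul_comm]
      gcongr
      rw [← Real.rpow_two]
      exact Real.rpow_le_rpow_of_exponent_ge hε0 (by linarith) (by linarith)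
    calc _ ≤ ENNReal.ofReal ((ε * δ) ^ 2) * (ENNReal.ofReal ((ε * δ) ^ (-s)) * (K * (M * D))) +
          (ENNReal.ofReal (h ^ 2) * ENNReal.ofReal (ε ^ (2 - s))) *
            (b * (2 ^ finrank ℝ E * D)) := by gcongr
      _ = _ := by
          rw [← mul_assoc (ENNReal.ofReal ((ε * δ) ^ 2)), h3]; ring
  calc ∫⁻ x in A, ENNReal.ofReal (‖x‖ ^ (-s)) * ‖u x‖ₑ ^ 2
      ≤ ∫⁻ x in A, (ENNReal.ofReal (‖x‖ ^ (-s)) * (2 * ‖ballMean u (ℓ x) x‖ₑ ^ 2) +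
          2 * (b⁻¹ * K) * (ENNReal.ofReal (‖x‖ ^ (-s)) * (ENNReal.ofReal (ℓ x ^ 2) *
            segmentEnergy (s / 2) u (ℓ x) x))) := by
        refine lintegral_mono fun x => ?_
        refine (mul_le_mul_right (enorm_sq_le_ballMean_add_segmentEnergy hu
          (a := s / 2) (by linarith) (ℓ x) x) _).trans (le_of_eq ?_)
        ring
    _ = (∫⁻ x in A, ENNReal.ofReal (‖x‖ ^ (-s)) * (2 * ‖ballMean u (ℓ x) x‖ₑ ^ 2)) +
          2 * (b⁻¹ * K) * ∫⁻ x in A, ENNReal.ofReal (‖x‖ ^ (-s)) * (ENNReal.ofReal (ℓ x ^ 2) *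
            segmentEnergy (s / 2) u (ℓ x) x) := by
        have hm : Measurable fun x => ENNReal.ofReal (‖x‖ ^ (-s)) * (ENNReal.ofReal (ℓ x ^ 2) *
            segmentEnergy (s / 2) u (ℓ x) x) :=
          hmW.mul (((hLip.continuous.measurable.pow_const 2).ennreal_ofReal).mul hmV)
        rw [lintegral_add_right _ (hm.const_mul _), lintegral_const_mul _ hm]
    _ ≤ _ := by
        refine add_le_add_right ?_ _
        calc _ ≤ 2 * (b⁻¹ * K) * (ENNReal.ofReal (h ^ 2) * (ENNReal.ofReal (ε ^ (2 - s)) *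
              ((K * M + b * 2 ^ finrank ℝ E) * D))) :=
              mul_le_mul_right ((setLIntegral_le_lintegral _ _).trans hrem) _
          _ = ENNReal.ofReal (h ^ 2) * (ENNReal.ofReal (ε ^ (2 - s)) * Z * D) := by
              rw [hZ]; ring
          _ ≤ ENNReal.ofReal (h ^ 2) * (1 * D) := by gcongr
          _ = _ := by rw [one_mul]

/-- Bessel's inequality for the local mean values of an orthonormal family. -/
theorem sum_ballMean_sq_le {n : ℕ} {ψ : Fin n → E → ℝ} (hc : ∀ i, Continuous (ψ i))
    (hs : ∀ i, HasCompactSupport (ψ i))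
    (ho : ∀ i j, ∫ x, ψ i x * ψ j x = if i = j then 1 else 0) {r : ℝ} (hr : 0 < r) (x : E) :
    ∑ i, ballMean (ψ i) r x ^ 2 ≤
      (volume.real (ball (0 : E) 1))⁻¹ * (r ^ finrank ℝ E)⁻¹ := by
  have hb : 0 < volume.real (ball (0 : E) 1) :=
    ENNReal.toReal_pos (measure_ball_pos volume _ one_pos).ne' measure_ball_lt_top.ne
  have hmain := sum_setIntegral_sq_le (volume : Measure E) (u := fun i z => ψ i (x + r • z))
    (κ := (r ^ finrank ℝ E)⁻¹) (B := ball (0 : E) 1) (fun i => (hc i).comp (by fun_prop))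
    (fun i => (hs i).comp_homeomorph
      ((Homeomorph.smulOfNeZero r hr.ne').trans (Homeomorph.addLeft x)))
    (by positivity) (fun i j => by
      rw [Measure.integral_comp_smul volume (fun z => ψ i (x + z) * ψ j (x + z)) r,
        integral_add_left_eq_self (fun z => ψ i z * ψ j z) x, ho, abs_of_pos (by positivity)]
      simp) measure_ball_lt_top.ne
  simp only [ballMean, mul_pow]
  rw [← Finset.mul_sum]
  calc _ ≤ (volume.real (ball (0 : E) 1))⁻¹ ^ 2 *
        ((r ^ finrank ℝ E)⁻¹ * volume.real (ball (0 : E) 1)) := by gcongr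
    _ = _ := by field_simp

theorem measurable_ballMean {u : E → ℝ} (hu : Continuous u) {ℓ : E → ℝ} (hℓ : Continuous ℓ) :
    Measurable fun x => ballMean u (ℓ x) x := by
  refine Measurable.const_mul ?_ _
  have hc : Continuous fun q : E × E => u (q.1 + ℓ q.1 • q.2) := hu.comp (by fun_prop)
  exact (hc.stronglyMeasurable.integral_prod_right
    (ν := volume.restrict (ball (0 : E) 1))).measurable

end TraceBound

section RadialIntegral

open Metric Module

variable {E : Type*} [NormedAddCommGroup E] [InnerProductSpace ℝ E] [FiniteDimensional ℝ E]
  [MeasurableSpace E] [BorelSpace E]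

theorem integrableOn_rpow_mul_max_rpow (hE : 1 ≤ finrank ℝ E) {s q δ : ℝ} (hs : s < finrank ℝ E)
    (hq : 0 ≤ q) (hδ : 0 < δ) (R : ℝ) :
    IntegrableOn (fun x : E => ‖x‖ ^ (-s) * max ‖x‖ δ ^ (-q)) (ball 0 R) := by
  refine integrableOn_ball_of_norm_le_rpow hE (C := δ ^ (-q)) hs ?_
    (by fun_prop : Measurable fun x : E => ‖x‖ ^ (-s) * max ‖x‖ δ ^ (-q)).aestronglyMeasurable
  refine Filter.Eventually.of_forall fun x => ?_
  rw [Real.norm_of_nonneg (by positivity), mul_comm]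
  exact mul_le_mul_of_nonneg_right
    (Real.rpow_le_rpow_of_nonpos hδ (le_max_right _ _) (by linarith)) (by positivity)

theorem setIntegral_rpow_mul_max_rpow (hE : 1 ≤ finrank ℝ E) {s q δ R : ℝ}
    (hs : s < finrank ℝ E) (hδ : 0 < δ) (hR : δ ≤ R) :
    ∫ x in ball (0 : E) R, ‖x‖ ^ (-s) * max ‖x‖ δ ^ (-q) =
      finrank ℝ E * volume.real (ball (0 : E) 1) *
        (δ ^ (finrank ℝ E - s - q) / (finrank ℝ E - s) +
          ∫ y in δ..R, y ^ (finrank ℝ E - s - q - 1)) := by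
  have hnt : Nontrivial E := nontrivial_of_finrank_pos (R := ℝ) (by lia)
  set n := finrank ℝ E with hn
  have hn1 : ((n - 1 : ℕ) : ℝ) = n - 1 := by push_cast [hE]; ring
  set F : ℝ → ℝ := fun y => y ^ (n - 1) * (y ^ (-s) * max y δ ^ (-q)) with hF
  have hF1 : ∀ y, 0 < y → y ≤ δ → F y = δ ^ (-q) * y ^ (n - 1 - s) := by
    intro y hy hyδ
    rw [hF]
    simp only [max_eq_right hyδ]
    rw [← Real.rpow_natCast, hn1, sub_eq_add_neg _ s, Real.rpow_add hy]
    ring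
  have hF2 : ∀ y, δ ≤ y → F y = y ^ (n - s - q - 1) := by
    intro y hyδ
    have hy : 0 < y := hδ.trans_le hyδ
    rw [hF]
    simp only [max_eq_left hyδ]
    rw [← Real.rpow_natCast, hn1, ← Real.rpow_add hy, ← Real.rpow_add hy]
    congr 1; ring
  have hI1 : ∫ y in (0 : ℝ)..δ, F y = δ ^ (n - s - q) / (n - s) := by
    rw [intervalIntegral.integral_congr_ae (g := fun y => δ ^ (-q) * y ^ (n - 1 - s))
      (Filter.Eventually.of_forall fun y hy => by
        rw [Set.uIoc_of_le hδ.le] at hy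
        exact hF1 y hy.1 hy.2), intervalIntegral.integral_const_mul,
      integral_rpow (Or.inl (by linarith)), show (n : ℝ) - 1 - s + 1 = n - s by ring,
      Real.zero_rpow (by linarith), sub_zero, ← mul_div_assoc, ← Real.rpow_add hδ]
    congr 2; ring
  have hI2 : ∫ y in δ..R, F y = ∫ y in δ..R, y ^ (n - s - q - 1) := by
    refine intervalIntegral.integral_congr fun y hy => ?_
    rw [Set.uIcc_of_le hR] at hy
    exact hF2 y hy.1
  have hi1 : IntervalIntegrable F volume 0 δ := by
    refine ((intervalIntegral.intervalIntegrable_rpow' (r := n - 1 - s)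
      (by linarith)).const_mul (δ ^ (-q))).congr ?_
    intro y hy
    rw [Set.uIoc_of_le hδ.le] at hy
    exact (hF1 y hy.1 hy.2).symm
  have hi2 : IntervalIntegrable F volume δ R := by
    refine (intervalIntegral.intervalIntegrable_rpow (r := n - s - q - 1)
      (Or.inr ?_)).congr ?_
    · rw [Set.uIcc_of_le hR]
      exact fun h0 => absurd h0.1 (by linarith)
    · intro y hy
      rw [Set.uIoc_of_le hR] at hy
      exact (hF2 y hy.1.le).symm
  set f : ℝ → ℝ := (Set.Iio R).indicator fun r => r ^ (-s) * max r δ ^ (-q) with hf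
  have hpolar := integral_fun_norm_addHaar (volume : Measure E) f
  have hleft : ∫ x in ball (0 : E) R, ‖x‖ ^ (-s) * max ‖x‖ δ ^ (-q) = ∫ x : E, f ‖x‖ := by
    rw [← integral_indicator measurableSet_ball]
    congr 1; funext x
    simp [hf, Set.indicator]
  have hright : ∫ y in Set.Ioi (0 : ℝ), y ^ (n - 1) • f y = ∫ y in (0 : ℝ)..R, F y := by
    rw [intervalIntegral.integral_of_le (hδ.le.trans hR), integral_Ioc_eq_integral_Ioo,
      ← Set.Ioi_inter_Iio, ← setIntegral_indicator measurableSet_Iio]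
    refine setIntegral_congr_fun measurableSet_Ioi fun y _ => ?_
    by_cases hy : y < R <;> simp [hf, hF, Set.indicator, hy]
  rw [hleft, hpolar, ← hn, hright, ← intervalIntegral.integral_add_adjacent_intervals hi1 hi2,
    hI1, hI2]
  simp only [nsmul_eq_mul, smul_eq_mul]
  ring

end RadialIntegral

section SemiclassicalTrace

open Metric Module

theorem ofReal_integral_le_lintegral_ofReal {α : Type*} [MeasurableSpace α] (ν : Measure α)
    (f : α → ℝ) : ENNReal.ofReal (∫ x, f x ∂ν) ≤ ∫⁻ x, ENNReal.ofReal (f x) ∂ν := by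
  by_cases hf : Integrable f ν
  · refine ENNReal.ofReal_le_of_le_toReal ?_
    rw [integral_eq_lintegral_pos_part_sub_lintegral_neg_part hf]
    exact sub_le_self _ ENNReal.toReal_nonneg
  · simp [integral_undef hf]

/-- A bound for the trace by an integral over the classically allowed region. -/
theorem exists_negTrace_le_setIntegral (d : ℕ) (hd : 2 ≤ d) (s μ : ℝ) (hs0 : 0 < s) (hs2 : s < 2)
    {R : ℝ} (hR0 : 0 < R) (hR : R ^ (-s) ≤ μ) :
    ∃ C > (0 : ℝ), ∀ h δ : ℝ, 0 < h → 0 < δ → h * δ ^ (s / 2) = δ →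
      negTrace d h (fun x => -‖x‖ ^ (-s) + μ) ≤ C * h ^ (-(d : ℝ)) *
        ∫ x in ball (0 : EuclideanSpace ℝ (Fin d)) R, ‖x‖ ^ (-s) * max ‖x‖ δ ^ (-(s / 2 * d)) := by
  set E := EuclideanSpace ℝ (Fin d) with hE
  have hfr : finrank ℝ E = d := finrank_euclideanSpace_fin
  have hd' : (2 : ℝ) ≤ d := by exact_mod_cast hd
  obtain ⟨ε, hε0, hε2, hkin⟩ := exists_setLIntegral_rpow_mul_sq_le (E := E) s hs0 hs2
    (hd.trans_eq hfr.symm)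
  set b := volume.real (ball (0 : E) 1) with hb
  have hb0 : 0 < b :=
    ENNReal.toReal_pos (measure_ball_pos volume _ one_pos).ne' measure_ball_lt_top.ne
  refine ⟨2 * b⁻¹ * (ε ^ d)⁻¹, by positivity, fun h δ hh hδ hscale => ?_⟩
  set A := ball (0 : E) R with hA
  set ℓ : E → ℝ := localLength s ε h δ with hℓ
  have hLip : LipschitzWith (1 / 2) ℓ :=
    lipschitzWith_localLength hs0.le hs2.le hε0.le hε2 hh.le hδ hscale
  have hint := integrableOn_rpow_mul_max_rpow (E := E) (one_le_two.trans (hd.trans_eq hfr.symm)) (s := s) (q := s / 2 * d)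
    (by rw [hfr]; linarith) (by positivity) hδ R
  refine csSup_le ⟨0, 0, fun i => 0, by simp, by simp, by simp, by simp⟩ ?_
  rintro T ⟨n, ψ, hsm, hcs, ho, rfl⟩
  have hψ1 : ∀ i, ContDiff ℝ 1 (ψ i) := fun i => (hsm i).of_le (by exact_mod_cast le_top)
  have hone : ∀ i, ENNReal.ofReal (max 0 (-(h ^ 2 * (∫ x, ‖fderiv ℝ (ψ i) x‖ ^ 2)
      + ∫ x, (-‖x‖ ^ (-s) + μ) * (ψ i x) ^ 2))) ≤
      ∫⁻ x in A, ENNReal.ofReal (‖x‖ ^ (-s)) * (2 * ‖ballMean (ψ i) (ℓ x) x‖ₑ ^ 2) := by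
    intro i
    have hT : ENNReal.ofReal (∫ x, ‖fderiv ℝ (ψ i) x‖ ^ 2) = ∫⁻ x, ‖fderiv ℝ (ψ i) x‖ₑ ^ 2 := by
      have hcf : Continuous fun x => ‖fderiv ℝ (ψ i) x‖ ^ 2 :=
        ((hψ1 i).continuous_fderiv one_ne_zero).norm.pow 2
      have hsf : HasCompactSupport fun x => ‖fderiv ℝ (ψ i) x‖ ^ 2 :=
        ((hcs i).fderiv ℝ).comp_left (g := fun L => ‖L‖ ^ 2) (by simp)
      rw [ofReal_integral_eq_lintegral_ofReal (hcf.integrable_of_hasCompactSupport hsf)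
        (Filter.Eventually.of_forall fun x => sq_nonneg _)]
      refine lintegral_congr fun x => ?_
      rw [ENNReal.ofReal_pow (norm_nonneg _), ofReal_norm]
    have hX : ENNReal.ofReal (-∫ x, (-‖x‖ ^ (-s) + μ) * (ψ i x) ^ 2) ≤
        ∫⁻ x in A, ENNReal.ofReal (‖x‖ ^ (-s)) * ‖ψ i x‖ₑ ^ 2 := by
      rw [← integral_neg, ← lintegral_indicator measurableSet_ball]
      refine (ofReal_integral_le_lintegral_ofReal _ _).trans (lintegral_mono fun x => ?_)
      by_cases hx : x ∈ A
      · rw [Set.indicator_of_mem hx, ← enorm_pow, Real.enorm_of_nonneg (sq_nonneg _),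
          ← ENNReal.ofReal_mul (Real.rpow_nonneg (norm_nonneg _) _)]
        refine ENNReal.ofReal_le_ofReal ?_
        have hμ : 0 ≤ μ := (Real.rpow_nonneg hR0.le _).trans hR
        nlinarith [mul_nonneg hμ (sq_nonneg (ψ i x))]
      · rw [Set.indicator_of_notMem hx, nonpos_iff_eq_zero, ENNReal.ofReal_eq_zero]
        have hx' : R ≤ ‖x‖ := by simpa [hA] using hx
        have h1 : ‖x‖ ^ (-s) ≤ μ :=
          (Real.rpow_le_rpow_of_nonpos hR0 hx' (by linarith)).trans hR
        have h2 : 0 ≤ (-‖x‖ ^ (-s) + μ) * ψ i x ^ 2 :=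
          mul_nonneg (by linarith) (sq_nonneg _)
        linarith
    have hk := hX.trans (hkin h δ hh hδ hscale (ψ i) (hψ1 i) A)
    rw [← hT, ← ENNReal.ofReal_mul (sq_nonneg h)] at hk
    have hTn : 0 ≤ h ^ 2 * ∫ x, ‖fderiv ℝ (ψ i) x‖ ^ 2 :=
      mul_nonneg (sq_nonneg h) (integral_nonneg fun x => sq_nonneg _)
    rw [neg_add_rev, ← sub_eq_add_neg, ENNReal.ofReal_max, ENNReal.ofReal_zero,
      ENNReal.ofReal_sub _ hTn, max_eq_right zero_le]
    exact tsub_le_iff_right.2 hk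
  have hsum : ENNReal.ofReal (∑ i, max 0 (-(h ^ 2 * (∫ x, ‖fderiv ℝ (ψ i) x‖ ^ 2)
      + ∫ x, (-‖x‖ ^ (-s) + μ) * (ψ i x) ^ 2))) ≤
      ∫⁻ x in A, ENNReal.ofReal (2 * b⁻¹ * (ε ^ d)⁻¹ * h ^ (-(d : ℝ)) *
        (‖x‖ ^ (-s) * max ‖x‖ δ ^ (-(s / 2 * d)))) := by
    rw [ENNReal.ofReal_sum_of_nonneg fun i _ => le_max_left _ _]
    refine (Finset.sum_le_sum fun i _ => hone i).trans ?_
    have hmeas : ∀ i, Measurable fun x : E =>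
        ENNReal.ofReal (‖x‖ ^ (-s)) * (2 * ‖ballMean (ψ i) (ℓ x) x‖ₑ ^ 2) := fun i =>
      (by fun_prop : Measurable fun x : E => ENNReal.ofReal (‖x‖ ^ (-s))).mul
        (((measurable_ballMean (hψ1 i).continuous hLip.continuous).enorm.pow_const 2).const_mul 2)
    rw [← lintegral_finsetSum _ fun i _ => hmeas i]
    refine lintegral_mono fun x => ?_
    have hbes := sum_ballMean_sq_le (fun i => (hψ1 i).continuous) hcs ho
      (localLength_pos (s := s) hε0 hh hδ x) x
    have hterm : ∀ i, ENNReal.ofReal (‖x‖ ^ (-s)) * (2 * ‖ballMean (ψ i) (ℓ x) x‖ₑ ^ 2) =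
        ENNReal.ofReal (‖x‖ ^ (-s) * (2 * ballMean (ψ i) (ℓ x) x ^ 2)) := by
      intro i
      rw [← enorm_pow, Real.enorm_of_nonneg (sq_nonneg _), ENNReal.ofReal_mul
        (Real.rpow_nonneg (norm_nonneg _) _), ENNReal.ofReal_mul zero_le_two,
        ENNReal.ofReal_ofNat]
    simp only [hterm]
    rw [← ENNReal.ofReal_sum_of_nonneg fun i _ => by positivity]
    refine ENNReal.ofReal_le_ofReal ?_
    rw [← Finset.mul_sum, ← Finset.mul_sum]
    have hlen : (localLength s ε h δ x ^ d)⁻¹ =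
        (ε ^ d)⁻¹ * h ^ (-(d : ℝ)) * max ‖x‖ δ ^ (-(s / 2 * d)) := by
      have hm : 0 < max ‖x‖ δ := lt_max_of_lt_right hδ
      rw [localLength, mul_pow, mul_pow, mul_inv, mul_inv, Real.rpow_neg hh.le,
        Real.rpow_natCast, Real.rpow_neg hm.le, Real.rpow_mul hm.le, Real.rpow_natCast, mul_assoc]
    rw [hfr, hlen] at hbes
    calc _ ≤ ‖x‖ ^ (-s) * (2 * (b⁻¹ * ((ε ^ d)⁻¹ * h ^ (-(d : ℝ)) *
          max ‖x‖ δ ^ (-(s / 2 * d))))) := by gcongr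
      _ = _ := by ring
  have hnn : ∀ x : E, 0 ≤ 2 * b⁻¹ * (ε ^ d)⁻¹ * h ^ (-(d : ℝ)) *
        (‖x‖ ^ (-s) * max ‖x‖ δ ^ (-(s / 2 * d))) := fun x => by positivity
  rw [← ofReal_integral_eq_lintegral_ofReal (hint.const_mul _)
    (Filter.Eventually.of_forall hnn), integral_const_mul] at hsum
  refine (ENNReal.ofReal_le_ofReal_iff ?_).1 hsum
  rw [← integral_const_mul]
  exact integral_nonneg hnn

theorem exists_negTrace_le (d : ℕ) (hd : 2 ≤ d) (s μ : ℝ) (hs0 : 0 < s) (hs2 : s < 2)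
    {R : ℝ} (hR1 : 1 ≤ R) (hR : R ^ (-s) ≤ μ) :
    ∃ C > (0 : ℝ), ∀ h : ℝ, 0 < h → h ≤ 1 →
      negTrace d h (fun x => -‖x‖ ^ (-s) + μ) ≤ C * (h ^ (-(d : ℝ)) *
        ((h ^ (2 / (2 - s))) ^ (d - s - s / 2 * d) / (d - s) +
          ∫ y in (h ^ (2 / (2 - s)))..R, y ^ (d - s - s / 2 * d - 1))) := by
  obtain ⟨C, hC, hle⟩ := exists_negTrace_le_setIntegral d hd s μ hs0 hs2 (by linarith) hR
  have hd' : (2 : ℝ) ≤ d := by exact_mod_cast hd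
  have hb0 : 0 < volume.real (ball (0 : EuclideanSpace ℝ (Fin d)) 1) :=
    ENNReal.toReal_pos (measure_ball_pos volume _ one_pos).ne' measure_ball_lt_top.ne
  refine ⟨C * (d * volume.real (ball (0 : EuclideanSpace ℝ (Fin d)) 1)), by positivity,
    fun h hh h1 => ?_⟩
  have hs : 0 < 2 - s := by linarith
  have hδ : 0 < h ^ (2 / (2 - s)) := Real.rpow_pos_of_pos hh _
  have hδ1 : h ^ (2 / (2 - s)) ≤ 1 := Real.rpow_le_one hh.le h1 (by positivity)
  have hscale : h * (h ^ (2 / (2 - s))) ^ (s / 2) = h ^ (2 / (2 - s)) := by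
    rw [← Real.rpow_mul hh.le]
    nth_rewrite 1 [← Real.rpow_one h]
    rw [← Real.rpow_add hh]
    congr 1; field_simp; ring
  refine (hle h _ hh hδ hscale).trans (le_of_eq ?_)
  have hfr : finrank ℝ (EuclideanSpace ℝ (Fin d)) = d := finrank_euclideanSpace_fin
  rw [setIntegral_rpow_mul_max_rpow (one_le_two.trans (hd.trans_eq hfr.symm))
    (by rw [hfr]; linarith) hδ (hδ1.trans hR1), hfr]
  ring

theorem integral_rpow_sub_one_le_of_pos {p δ R : ℝ} (hp : 0 < p) (hδ : 0 < δ) :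
    ∫ y in δ..R, y ^ (p - 1) ≤ R ^ p / p := by
  rw [integral_rpow (Or.inl (by linarith)), sub_add_cancel]
  gcongr
  exact sub_le_self _ (Real.rpow_nonneg hδ.le _)

theorem integral_rpow_sub_one_le_of_neg {p δ R : ℝ} (hp : p < 0) (hδ : 0 < δ) (hR : δ ≤ R) :
    ∫ y in δ..R, y ^ (p - 1) ≤ δ ^ p / (-p) := by
  rw [integral_rpow (Or.inr ⟨by linarith, by
    rw [Set.uIcc_of_le hR]; exact fun h0 => absurd h0.1 (by linarith)⟩), sub_add_cancel,
    ← neg_div_neg_eq, neg_sub]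
  have : 0 < -p := by linarith
  gcongr
  exact sub_le_self _ (Real.rpow_nonneg (hδ.le.trans hR) _)

theorem integral_rpow_neg_one {δ R : ℝ} (hδ : 0 < δ) (hR : 0 < R) :
    ∫ y in δ..R, y ^ (-1 : ℝ) = Real.log R - Real.log δ := by
  simp only [Real.rpow_neg_one]
  rw [integral_inv_of_pos hδ hR, Real.log_div hR.ne' hδ.ne']

end SemiclassicalTrace

/-- the semiclassical behaviour of `tr[-h²Δ - |x|^{-s} + μ]₋` as `h ↓ 0`,
with critical exponent `s_c = 2d/(d+2)`. -/
theorem trace_singular_potential_asymptotics (d : ℕ) (hd : 2 ≤ d) (s μ : ℝ)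
    (hs0 : 0 < s) (hs2 : s < 2) (hμ : 0 < μ) :
    (s < 2 * d / (d + 2) →
      ∃ C > (0:ℝ), ∃ h₀ > (0:ℝ), ∀ h : ℝ, 0 < h → h ≤ h₀ →
        negTrace d h (fun x => -‖x‖ ^ (-s) + μ) ≤ C * h ^ (-(d:ℝ))) ∧
    (s = 2 * d / (d + 2) →
      ∃ C > (0:ℝ), ∃ h₀ > (0:ℝ), ∀ h : ℝ, 0 < h → h ≤ h₀ →
        negTrace d h (fun x => -‖x‖ ^ (-s) + μ) ≤ C * h ^ (-(d:ℝ)) * |Real.log h|) ∧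
    (2 * d / (d + 2) < s →
      ∃ C > (0:ℝ), ∃ h₀ > (0:ℝ), ∀ h : ℝ, 0 < h → h ≤ h₀ →
        negTrace d h (fun x => -‖x‖ ^ (-s) + μ) ≤ C * h ^ (-(2 * s) / (2 - s))) := by
  obtain ⟨R, hR1, hR⟩ : ∃ R : ℝ, 1 ≤ R ∧ R ^ (-s) ≤ μ := by
    refine ⟨max 1 (μ ^ (-1 / s)), le_max_left _ _, ?_⟩
    calc _ ≤ (μ ^ (-1 / s)) ^ (-s) := Real.rpow_le_rpow_of_nonpos
          (Real.rpow_pos_of_pos hμ _) (le_max_right _ _) (by linarith)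
      _ = μ := by
        rw [← Real.rpow_mul hμ.le, show -1 / s * -s = 1 by field_simp, Real.rpow_one]
  obtain ⟨C, hC, hle⟩ := exists_negTrace_le d hd s μ hs0 hs2 hR1 hR
  have hd' : (2 : ℝ) ≤ d := by exact_mod_cast hd
  have hs : 0 < 2 - s := by linarith
  have hds : 0 < d - s := by linarith
  have hR0 : 0 < R := by linarith
  have hδ : ∀ h : ℝ, 0 < h → 0 < h ^ (2 / (2 - s)) := fun h hh => Real.rpow_pos_of_pos hh _
  have hδ1 : ∀ h : ℝ, 0 < h → h ≤ 1 → h ^ (2 / (2 - s)) ≤ 1 := fun h hh h1 =>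
    Real.rpow_le_one hh.le h1 (by positivity)
  have hexp : (d : ℝ) - s - s / 2 * d = (2 * d - s * (d + 2)) / 2 := by ring
  refine ⟨fun hlt => ?_, fun heq => ?_, fun hgt => ?_⟩
  · have hp : 0 < (d : ℝ) - s - s / 2 * d := by
      rw [lt_div_iff₀ (by positivity)] at hlt
      rw [hexp]; linarith
    refine ⟨C * (1 / (d - s) + R ^ (d - s - s / 2 * d) / (d - s - s / 2 * d)),
      by positivity, 1, one_pos, fun h hh h1 => ?_⟩
    have h2 : (h ^ (2 / (2 - s))) ^ ((d : ℝ) - s - s / 2 * d) ≤ 1 :=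
      Real.rpow_le_one (hδ h hh).le (hδ1 h hh h1) hp.le
    calc _ ≤ _ := hle h hh h1
      _ ≤ C * (h ^ (-(d : ℝ)) * (1 / (d - s) +
          R ^ (d - s - s / 2 * d) / (d - s - s / 2 * d))) := by
        have := integral_rpow_sub_one_le_of_pos (R := R) hp (hδ h hh)
        gcongr
      _ = _ := by ring
  · have hp : (d : ℝ) - s - s / 2 * d = 0 := by
      rw [eq_div_iff (by positivity)] at heq
      rw [hexp, heq]; ring
    refine ⟨C * (1 / (d - s) + (Real.log R + 2 / (2 - s))),
      by have := Real.log_nonneg hR1; positivity, Real.exp (-1), Real.exp_pos _,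
      fun h hh h1 => ?_⟩
    have hlog : Real.log h ≤ -1 := by
      rw [← Real.log_exp (-1)]; exact Real.log_le_log hh h1
    have habs : |Real.log h| = -Real.log h := abs_of_nonpos (by linarith)
    have hL : 1 ≤ -Real.log h := by linarith
    have h1' : h ≤ 1 := h1.trans (Real.exp_le_one_iff.2 (by norm_num))
    have hle' := hle h hh h1'
    rw [hp, Real.rpow_zero, zero_sub, integral_rpow_neg_one (hδ h hh) hR0,
      Real.log_rpow hh] at hle'
    have hb : 1 / (d - s) + (Real.log R - 2 / (2 - s) * Real.log h) ≤
        (1 / (d - s) + (Real.log R + 2 / (2 - s))) * -Real.log h := by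
      have h3 : 0 ≤ 1 / (d - s) + Real.log R :=
        add_nonneg (by positivity) (Real.log_nonneg hR1)
      nlinarith
    rw [habs]
    calc _ ≤ _ := hle'
      _ ≤ C * (h ^ (-(d : ℝ)) *
          ((1 / (d - s) + (Real.log R + 2 / (2 - s))) * -Real.log h)) := by gcongr
      _ = _ := by ring
  · have hp : (d : ℝ) - s - s / 2 * d < 0 := by
      rw [div_lt_iff₀ (by positivity)] at hgt
      rw [hexp]; linarith
    have hp' : 0 < -((d : ℝ) - s - s / 2 * d) := by linarith
    refine ⟨C * (1 / (d - s) + 1 / (-(d - s - s / 2 * d))), by positivity, 1, one_pos,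
      fun h hh h1 => ?_⟩
    have hpow : h ^ (-(2 * s) / (2 - s)) =
        h ^ (-(d : ℝ)) * (h ^ (2 / (2 - s))) ^ ((d : ℝ) - s - s / 2 * d) := by
      rw [← Real.rpow_mul hh.le, ← Real.rpow_add hh]
      congr 1; field_simp; ring
    calc _ ≤ _ := hle h hh h1
      _ ≤ C * (h ^ (-(d : ℝ)) * ((h ^ (2 / (2 - s))) ^ ((d : ℝ) - s - s / 2 * d) / (d - s) +
          (h ^ (2 / (2 - s))) ^ ((d : ℝ) - s - s / 2 * d) / (-(d - s - s / 2 * d)))) := by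
        have := integral_rpow_sub_one_le_of_neg (R := R) hp (hδ h hh)
          ((hδ1 h hh h1).trans hR1)
        gcongr
      _ = _ := by rw [hpow]; ring
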